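/- (Zaslavsky's Balance Theorem) A signed graph (G, σ) is balanced if and only if σ is switching-equivalent to the all-positive signature, i.e., if and only if there exists a vertex subset U ⊆ V(G) such that σ^U assigns +1 to every edge of G. -/

import Mathlib

namespace SignedPaper

variable {V : Type*}

/-- `σ` is a signature of `G`: symmetric, and valued in `{+1, -1}` on adjacent pairs. -/
def IsSignature (G : SimpleGraph V) (σ : V → V → ℤ) : Prop :=
  (∀ u v, σ u v = σ v u) ∧ ∀ ⦃u v⦄, G.Adj u v → σ u v = 1 ∨ σ u v = -1

/-- The switch of the signature `σ` at a vertex subset `U`: the sign of an edge is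
negated iff exactly one endpoint lies in `U`. -/
noncomputable def switch (σ : V → V → ℤ) (U : Set V) (u v : V) : ℤ :=
  @ite _ ((u ∈ U) ↔ (v ∈ U)) (Classical.propDecidable _) (σ u v) (-σ u v)

/-- The sign of a walk: the product of the signs of its edges. -/
def walkSign {G : SimpleGraph V} (σ : V → V → ℤ) : ∀ {u v : V}, G.Walk u v → ℤ
  | _, _, .nil => 1
  | _, _, @SimpleGraph.Walk.cons _ _ u x _ _ p => σ u x * walkSign σ p

/-- `(G, σ)` is balanced: every cycle is positive. -/
def IsBalanced (G : SimpleGraph V) (σ : V → V → ℤ) : Prop :=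
  ∀ ⦃v : V⦄ (W : G.Walk v v), W.IsCycle → walkSign σ W = 1

/-- A proper coloring of the signed graph `(G, σ)`. -/
def ProperColoring (G : SimpleGraph V) (σ : V → V → ℤ) (c : V → ℤ) : Prop :=
  ∀ ⦃u v⦄, G.Adj u v → c u ≠ σ u v * c v

/-- A proper `L`-coloring of the signed graph `(G, σ)`. -/
def ProperListColoring (G : SimpleGraph V) (σ : V → V → ℤ)
    (L : V → Finset ℤ) (c : V → ℤ) : Prop :=
  (∀ v, c v ∈ L v) ∧ ProperColoring G σ c

/-- `(G, σ)` is signed `k`-choosable. -/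
def SignedChoosable (G : SimpleGraph V) (σ : V → V → ℤ) (k : ℕ) : Prop :=
  ∀ L : V → Finset ℤ, (∀ v, k ≤ (L v).card) → ∃ c, ProperListColoring G σ L c

/-- The signed list chromatic number `χ_ℓ^s(G, σ)`. -/
noncomputable def signedChoiceNumber (G : SimpleGraph V) (σ : V → V → ℤ) : ℕ :=
  sInf {k | SignedChoosable G σ k}

/-- Classical (unsigned) `k`-choosability with integer colors. -/
def Choosable (G : SimpleGraph V) (k : ℕ) : Prop :=
  ∀ L : V → Finset ℤ, (∀ v, k ≤ (L v).card) →
    ∃ c : V → ℤ, (∀ v, c v ∈ L v) ∧ ∀ ⦃u v⦄, G.Adj u v → c u ≠ c v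

/-- The classical list chromatic number `χ_ℓ(G)`. -/
noncomputable def choiceNumber (G : SimpleGraph V) : ℕ :=
  sInf {k | Choosable G k}

theorem walkSign_append {G : SimpleGraph V} (σ : V → V → ℤ) {u v w : V} (p : G.Walk u v)
    (q : G.Walk v w) : walkSign σ (p.append q) = walkSign σ p * walkSign σ q := by
  induction p with
  | nil => simp [walkSign]
  | cons h p ih => simp [walkSign, ih, mul_assoc]

theorem walkSign_reverse {G : SimpleGraph V} (σ : V → V → ℤ) (hs : ∀ u v, σ u v = σ v u)
    {u v : V} (p : G.Walk u v) : walkSign σ p.reverse = walkSign σ p := by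
  induction p with
  | nil => simp [walkSign]
  | cons h p ih =>
    rw [SimpleGraph.Walk.reverse_cons, walkSign_append, ih]
    simp only [walkSign, mul_one]
    rw [hs, mul_comm]

theorem walkSign_pm {G : SimpleGraph V} (σ : V → V → ℤ) (hσ : IsSignature G σ)
    {u v : V} (p : G.Walk u v) : walkSign σ p = 1 ∨ walkSign σ p = -1 := by
  induction p with
  | nil => simp [walkSign]
  | cons h p ih =>
    rcases ih with e | e <;> rcases hσ.2 h with e' | e' <;> simp [walkSign, e, e']

theorem walkSign_cons_path {G : SimpleGraph V} (σ : V → V → ℤ) (hσ : IsSignature G σ)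
    (hb : IsBalanced G σ) {u x : V} (h : G.Adj u x) (p : G.Walk x u) (hp : p.IsPath) :
    σ u x * walkSign σ p = 1 := by
  by_cases he : s(u, x) ∈ p.edges
  · cases p with
    | nil => simp at he
    | @cons _ y _ h' q =>
      rw [SimpleGraph.Walk.cons_isPath_iff] at hp
      rw [SimpleGraph.Walk.edges_cons, List.mem_cons] at he
      rcases he with he | he
      · have hy : y = u := by
          rw [Sym2.eq_iff] at he
          rcases he with ⟨a, b⟩ | ⟨a, b⟩
          · exact absurd a h.ne
          · exact a.symm
        subst hy
        have hq : q = SimpleGraph.Walk.nil := SimpleGraph.Walk.isPath_iff_eq_nil.mp hp.1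
        subst hq
        simp only [walkSign, mul_one]
        rw [hσ.1 x y]
        rcases hσ.2 h with e | e <;> simp [e]
      · exact absurd (q.snd_mem_support_of_mem_edges he) hp.2
  · exact hb (.cons h p) ((SimpleGraph.Walk.cons_isCycle_iff p h).2 ⟨hp, he⟩)

theorem walkSign_bypass {G : SimpleGraph V} [DecidableEq V] (σ : V → V → ℤ)
    (hσ : IsSignature G σ) (hb : IsBalanced G σ) {u v : V} (p : G.Walk u v) :
    walkSign σ p.bypass = walkSign σ p := by
  induction p with
  | nil => rfl
  | @cons u x w h p ih =>
    simp only [SimpleGraph.Walk.bypass]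
    split_ifs with hs
    · have h1 := walkSign_cons_path σ hσ hb h _ (p.bypass_isPath.takeUntil hs)
      have h2 := walkSign_append σ (p.bypass.takeUntil u hs) (p.bypass.dropUntil u hs)
      rw [SimpleGraph.Walk.take_spec, ih] at h2
      simp only [walkSign]
      rw [h2, ← mul_assoc, h1, one_mul]
    · simp only [walkSign, ih]

theorem walkSign_closed {G : SimpleGraph V} (σ : V → V → ℤ)
    (hσ : IsSignature G σ) (hb : IsBalanced G σ) {u : V} (p : G.Walk u u) :
    walkSign σ p = 1 := by
  classical
  rw [← walkSign_bypass σ hσ hb, SimpleGraph.Walk.isPath_iff_eq_nil.mp p.bypass_isPath]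
  rfl

theorem walkSign_of_switch {G : SimpleGraph V} (σ : V → V → ℤ) (U : Set V)
    (hU : ∀ ⦃u v⦄, G.Adj u v → switch σ U u v = 1) {u v : V} (p : G.Walk u v) :
    ((u ∈ U ↔ v ∈ U) → walkSign σ p = 1) ∧ (¬ (u ∈ U ↔ v ∈ U) → walkSign σ p = -1) := by
  induction p with
  | nil => simp [walkSign]
  | @cons u x w h p ih =>
    have := hU h
    unfold switch at this
    simp only [walkSign]
    split_ifs at this with hx
    · rw [this, hx, one_mul]; exact ih
    · have e : σ u x = -1 := by omega
      rw [e]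
      by_cases h1 : x ∈ U ↔ w ∈ U
      · rw [ih.1 h1]; constructor
        · intro; tauto
        · intro; rfl
      · rw [ih.2 h1]; constructor
        · intro; rfl
        · intro; tauto

/-- Zaslavsky's Balance Theorem: `(G, σ)` is balanced iff there is a
vertex subset `U` such that the switched signature `σ^U` assigns `+1` to every edge. -/
theorem zaslavsky_balance (G : SimpleGraph V) [Fintype V]
    (σ : V → V → ℤ) (hσ : IsSignature G σ) :
    IsBalanced G σ ↔ ∃ U : Set V, ∀ ⦃u v⦄, G.Adj u v → switch σ U u v = 1 := by
  constructor
  · intro hb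
    have hr : ∀ v : V, G.Reachable (G.connectedComponentMk v).out v := fun v =>
      SimpleGraph.ConnectedComponent.exact (Quot.out_eq (G.connectedComponentMk v))
    have key : ∀ v : V, ∃ e : ℤ, (e = 1 ∨ e = -1) ∧
        ∀ p : G.Walk (G.connectedComponentMk v).out v, walkSign σ p = e := by
      intro v
      obtain ⟨p⟩ := hr v
      refine ⟨walkSign σ p, walkSign_pm σ hσ p, fun q => ?_⟩
      have := walkSign_closed σ hσ hb (q.append p.reverse)
      rw [walkSign_append, walkSign_reverse σ hσ.1] at this
      rcases walkSign_pm σ hσ p with e | e <;> rw [e] at this ⊢ <;> omega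
    choose c hc hp using key
    refine ⟨{v | c v = 1}, fun u v h => ?_⟩
    have hcomp : G.connectedComponentMk v = G.connectedComponentMk u :=
      SimpleGraph.ConnectedComponent.sound h.symm.reachable
    have hpv := hp v
    rw [hcomp] at hpv
    obtain ⟨p⟩ := hr u
    have h1 := hp u p
    have h2 := hpv (p.append (.cons h .nil))
    rw [walkSign_append, h1] at h2
    simp only [walkSign, mul_one] at h2
    unfold switch
    simp only [Set.mem_setOf_eq]
    rcases hc u with e | e <;> rcases hc v with e' | e' <;> rw [e, e'] at h2 <;>
      simp [e, e'] <;> omega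
  · rintro ⟨U, hU⟩ v W -
    exact (walkSign_of_switch σ U hU W).1 Iff.rfl

end SignedPaper
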